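/- Assume k is finite-dimensional and perfect and κ is derivation invariant. Let D₁,…,D_t be derivations of k such that the cohomology classes of κ_{D₁},…,κ_{D_t} form a basis of H²(k) = Z²(k)/B²(k), and let S₁,…,S_m ∈ cent₊(k) be such that κ_{S₁},…,κ_{S_m} form a basis of the space of invariant symmetric bilinear forms on k. Then every 2-cocycle ω of the current algebra A ⊗ k with values in an 𝔽-vector space M is cohomologous to a cocycle of the form (a⊗x, b⊗y) ↦ Σᵢ fᵢ(ab)·κ(Dᵢ x, y) + Σⱼ Fⱼ(a,b)·κ(Sⱼ x, y) for suitable linear maps fᵢ : A → M and Hochschild maps Fⱼ : A × A → M; that is, there exists a linear map ℓ : A ⊗ k → M such that ω(a⊗x, b⊗y) = Σᵢ fᵢ(ab)κ(Dᵢx,y) + Σⱼ Fⱼ(a,b)κ(Sⱼx,y) + ℓ((ab)⊗[x,y]) for all a,b ∈ A and x,y ∈ k. -/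

import Mathlib

open scoped TensorProduct

section Factor

variable {𝔽 U V W : Type*} [Field 𝔽] [AddCommGroup U] [Module 𝔽 U] [AddCommGroup V] [Module 𝔽 V]
  [AddCommGroup W] [Module 𝔽 W]

theorem eq_zero_of_forall_functional_eq_zero {w : W} (h : ∀ L : W →ₗ[𝔽] 𝔽, L w = 0) : w = 0 :=
  (Module.forall_dual_apply_eq_zero_iff 𝔽 w).1 h

theorem exists_factor_of_ker_le (p : V →ₗ[𝔽] U) (q : V →ₗ[𝔽] W) (h : ∀ v, p v = 0 → q v = 0) :
    ∃ G : U →ₗ[𝔽] W, ∀ v, G (p v) = q v := by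
  obtain ⟨s, hs⟩ := p.rangeRestrict.exists_rightInverse_of_surjective p.range_rangeRestrict
  obtain ⟨G, hG⟩ := LinearMap.exists_extend (q ∘ₗ s)
  refine ⟨G, fun v => ?_⟩
  have h1 : G (p v) = q (s (p.rangeRestrict v)) := LinearMap.congr_fun hG (p.rangeRestrict v)
  have h2 : p (s (p.rangeRestrict v)) = p v :=
    congrArg Subtype.val (LinearMap.congr_fun hs (p.rangeRestrict v))
  rw [h1, ← sub_eq_zero, ← map_sub]
  exact h _ (by rw [map_sub, h2, sub_self])

/-- A bilinear map `q` all of whose scalar components factor through the bilinear map `p`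
factors through `p`. -/
theorem exists_bilinear_factor {X : Type*} [AddCommGroup X] [Module 𝔽 X]
    (p : X →ₗ[𝔽] X →ₗ[𝔽] U) (q : X →ₗ[𝔽] X →ₗ[𝔽] W)
    (h : ∀ L : W →ₗ[𝔽] 𝔽, ∃ g : U →ₗ[𝔽] 𝔽, ∀ x y, L (q x y) = g (p x y)) :
    ∃ G : U →ₗ[𝔽] W, ∀ x y, q x y = G (p x y) := by
  obtain ⟨G, hG⟩ := exists_factor_of_ker_le (TensorProduct.lift p) (TensorProduct.lift q) (by
    intro v hv
    refine eq_zero_of_forall_functional_eq_zero (𝔽 := 𝔽) fun L => ?_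
    obtain ⟨g, hg⟩ := h L
    have : L ∘ₗ TensorProduct.lift q = g ∘ₗ TensorProduct.lift p :=
      TensorProduct.ext' fun x y => by simpa using hg x y
    have := LinearMap.congr_fun this v
    simpa [hv] using this)
  exact ⟨G, fun x y => by simpa using (hG (x ⊗ₜ y)).symm⟩

end Factor

section Forms

variable {𝔽 k : Type*} [Field 𝔽] [LieRing k] [LieAlgebra 𝔽 k]

theorem exists_endomorphism_of_form [FiniteDimensional 𝔽 k] {κ : k →ₗ[𝔽] k →ₗ[𝔽] 𝔽}
    (hκnd : ∀ x : k, (∀ y : k, κ x y = 0) → x = 0) (B : k →ₗ[𝔽] k →ₗ[𝔽] 𝔽) :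
    ∃ T : k →ₗ[𝔽] k, ∀ x y, κ (T x) y = B x y := by
  have hinj : Function.Injective κ := (injective_iff_map_eq_zero κ).2 fun x hx =>
    hκnd x fun y => by rw [hx, LinearMap.zero_apply]
  let e := LinearEquiv.ofInjectiveOfFinrankEq κ hinj Subspace.dual_finrank_eq.symm
  refine ⟨e.symm.toLinearMap ∘ₗ B, fun x y => ?_⟩
  exact LinearMap.congr_fun (e.apply_symm_apply (B x)) y

/-- If the 3-cocycle of a symmetric invariant form is the coboundary of a skew form, then the
symmetric form vanishes, provided all derivations are skew. -/
theorem invariant_form_eq_zero_of_coboundary [CharZero 𝔽] [FiniteDimensional 𝔽 k]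
    {κ : k →ₗ[𝔽] k →ₗ[𝔽] 𝔽}
    (hκsymm : ∀ x y : k, κ x y = κ y x)
    (hκinv : ∀ x y z : k, κ ⁅x, y⁆ z = κ x ⁅y, z⁆)
    (hκnd : ∀ x : k, (∀ y : k, κ x y = 0) → x = 0)
    (hderinv : ∀ D : k →ₗ[𝔽] k, (∀ x y : k, D ⁅x, y⁆ = ⁅D x, y⁆ + ⁅x, D y⁆) →
      ∀ x y : k, κ (D x) y = - κ x (D y))
    (B C : k →ₗ[𝔽] k →ₗ[𝔽] 𝔽) (hBsymm : ∀ x y, B x y = B y x)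
    (hBinv : ∀ x y z, B ⁅x, y⁆ z = B x ⁅y, z⁆) (hC : ∀ x y, C x y = -C y x)
    (hBC : ∀ x y z, B ⁅x, y⁆ z + C ⁅x, y⁆ z = C x ⁅y, z⁆ - C y ⁅x, z⁆) (x y : k) :
    B x y = 0 := by
  obtain ⟨D, hD⟩ := exists_endomorphism_of_form hκnd (C - B)
  have hder : ∀ x y : k, D ⁅x, y⁆ = ⁅D x, y⁆ + ⁅x, D y⁆ := by
    intro x y
    refine sub_eq_zero.1 (hκnd _ fun z => ?_)
    have h1 := hBC x y z
    have h2 := hBinv x y z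
    have h3 : B y ⁅x, z⁆ = -B x ⁅y, z⁆ := by
      rw [hBsymm x, hBinv, ← lie_skew, map_neg]
    rw [← lie_skew x (D y)]
    simp only [map_sub, map_add, map_neg, LinearMap.sub_apply, LinearMap.add_apply,
      LinearMap.neg_apply, hκinv, hD]
    linear_combination h1 - 2 * h2 - h3
  have h := hderinv D hder x y
  rw [hκsymm x, hD, hD] at h
  simp only [LinearMap.sub_apply] at h
  have : (2 : 𝔽) * B x y = 0 := by
    linear_combination -h + hC x y + hBsymm x y
  simpa using this

theorem bilinear_ext_of_perfect {W : Type*} [AddCommGroup W] [Module 𝔽 W]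
    (hperf : ∀ z : k, z ∈ Submodule.span 𝔽 {w : k | ∃ x y : k, ⁅x, y⁆ = w})
    {f g : k →ₗ[𝔽] W} (h : ∀ x y : k, f ⁅x, y⁆ = g ⁅x, y⁆) : f = g := by
  refine LinearMap.ext_on (Submodule.eq_top_iff'.2 hperf) ?_
  rintro _ ⟨x, y, rfl⟩
  exact h x y

end Forms

section Current

variable {𝔽 k A M : Type*} [Field 𝔽] [LieRing k] [LieAlgebra 𝔽 k] [CommRing A] [Algebra 𝔽 A]
  [AddCommGroup M] [Module 𝔽 M]

/-- The map `(x, y, a, b) ↦ ω (a ⊗ x) (b ⊗ y)`. -/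
def currentComponents (ω : (A ⊗[𝔽] k) →ₗ[𝔽] (A ⊗[𝔽] k) →ₗ[𝔽] M) :
    k →ₗ[𝔽] k →ₗ[𝔽] A →ₗ[𝔽] A →ₗ[𝔽] M :=
  LinearMap.mk₂ 𝔽
    (fun x y => ω.compl₁₂ ((TensorProduct.mk 𝔽 A k).flip x) ((TensorProduct.mk 𝔽 A k).flip y))
    (fun _ _ _ => by ext; simp) (fun _ _ _ => by ext; simp)
    (fun _ _ _ => by ext; simp) (fun _ _ _ => by ext; simp)

/-- The map `w` minus `w` with its two arguments in `A` exchanged. -/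
def skewPart (w : k →ₗ[𝔽] k →ₗ[𝔽] A →ₗ[𝔽] A →ₗ[𝔽] M) : k →ₗ[𝔽] k →ₗ[𝔽] A →ₗ[𝔽] A →ₗ[𝔽] M :=
  w.compr₂ (LinearMap.id - LinearMap.lflip.toLinearMap)

/-- The map `w` plus `w` with its two arguments in `A` exchanged. -/
def symmPart (w : k →ₗ[𝔽] k →ₗ[𝔽] A →ₗ[𝔽] A →ₗ[𝔽] M) : k →ₗ[𝔽] k →ₗ[𝔽] A →ₗ[𝔽] A →ₗ[𝔽] M :=
  w.compr₂ (LinearMap.id + LinearMap.lflip.toLinearMap)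

theorem skewPart_apply (w : k →ₗ[𝔽] k →ₗ[𝔽] A →ₗ[𝔽] A →ₗ[𝔽] M) (x y : k) (a b : A) :
    skewPart w x y a b = w x y a b - w x y b a := rfl

theorem symmPart_apply (w : k →ₗ[𝔽] k →ₗ[𝔽] A →ₗ[𝔽] A →ₗ[𝔽] M) (x y : k) (a b : A) :
    symmPart w x y a b = w x y a b + w x y b a := rfl

theorem skewPart_add_symmPart (w : k →ₗ[𝔽] k →ₗ[𝔽] A →ₗ[𝔽] A →ₗ[𝔽] M) (x y : k) (a b : A) :
    skewPart w x y a b + symmPart w x y a b = (2 : 𝔽) • w x y a b := by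
  simp only [skewPart_apply, symmPart_apply]; module

/-- Evaluation of a bilinear map at a pair. -/
def evalPair (a b : A) : (A →ₗ[𝔽] A →ₗ[𝔽] M) →ₗ[𝔽] M :=
  LinearMap.applyₗ (R := 𝔽) b ∘ₗ LinearMap.applyₗ (R := 𝔽) a

variable {w : k →ₗ[𝔽] k →ₗ[𝔽] A →ₗ[𝔽] A →ₗ[𝔽] M}

theorem skewPart_swap (w : k →ₗ[𝔽] k →ₗ[𝔽] A →ₗ[𝔽] A →ₗ[𝔽] M) (x y : k) (a b : A) :
    skewPart w x y a b = -skewPart w x y b a := by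
  simp only [skewPart_apply]; abel

theorem skewPart_symm (hw : ∀ x y a b, w x y a b = -w y x b a) (x y : k) (a b : A) :
    skewPart w x y a b = skewPart w y x a b := by
  simp only [skewPart_apply, hw x y]; abel

theorem symmPart_skew (hw : ∀ x y a b, w x y a b = -w y x b a) (x y : k) (a b : A) :
    symmPart w x y a b = -symmPart w y x a b := by
  simp only [symmPart_apply, hw x y]; abel

theorem skewPart_lie_swap
    (hcoc : ∀ x y z a b c, w ⁅x, y⁆ z (a * b) c = w x ⁅y, z⁆ a (b * c) - w y ⁅x, z⁆ b (a * c))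
    (x y z : k) (a b : A) : skewPart w x ⁅y, z⁆ a b = -skewPart w y ⁅x, z⁆ a b := by
  have h1 := hcoc x y z a b 1
  have h2 := hcoc x y z b a 1
  rw [mul_comm b a] at h2
  simp only [mul_one] at h1 h2
  simp only [skewPart_apply]
  linear_combination (norm := module) h2 - h1

theorem skewPart_invariant (hw : ∀ x y a b, w x y a b = -w y x b a)
    (hcoc : ∀ x y z a b c, w ⁅x, y⁆ z (a * b) c = w x ⁅y, z⁆ a (b * c) - w y ⁅x, z⁆ b (a * c))
    (x y z : k) (a b : A) : skewPart w ⁅x, y⁆ z a b = skewPart w x ⁅y, z⁆ a b := by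
  rw [skewPart_symm hw, skewPart_lie_swap hcoc, ← lie_skew y z]
  simp only [map_neg, LinearMap.neg_apply]

theorem two_smul_component_lie
    (hcoc : ∀ x y z a b c, w ⁅x, y⁆ z (a * b) c = w x ⁅y, z⁆ a (b * c) - w y ⁅x, z⁆ b (a * c))
    (x y z : k) (a b : A) :
    (2 : 𝔽) • w ⁅x, y⁆ z (a * b) 1 = symmPart w x ⁅y, z⁆ a b - symmPart w y ⁅x, z⁆ a b := by
  have h1 := hcoc x y z a b 1
  have h2 := hcoc x y z b a 1
  rw [mul_comm b a] at h2
  simp only [mul_one] at h1 h2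
  simp only [symmPart_apply]
  linear_combination (norm := module) h1 + h2

theorem symmPart_cocycle
    (hone : ∀ x y c, skewPart w x y c 1 = 0)
    (hcoc : ∀ x y z a b c, w ⁅x, y⁆ z (a * b) c = w x ⁅y, z⁆ a (b * c) - w y ⁅x, z⁆ b (a * c))
    (x y z : k) (c : A) :
    symmPart w ⁅x, y⁆ z c 1 = symmPart w x ⁅y, z⁆ c 1 - symmPart w y ⁅x, z⁆ c 1 := by
  have h := two_smul_component_lie hcoc x y z c 1
  rwa [mul_one, ← skewPart_add_symmPart, hone, zero_add] at h

variable [CharZero 𝔽]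

theorem symmPart_eq_mul_one
    (hperf : ∀ z : k, z ∈ Submodule.span 𝔽 {w : k | ∃ x y : k, ⁅x, y⁆ = w})
    (hcoc : ∀ x y z a b c, w ⁅x, y⁆ z (a * b) c = w x ⁅y, z⁆ a (b * c) - w y ⁅x, z⁆ b (a * c))
    (x y : k) (a b : A) : symmPart w x y a b = symmPart w x y (a * b) 1 := by
  have hswap : ∀ x y z, symmPart w x ⁅y, z⁆ a b - symmPart w x ⁅y, z⁆ (a * b) 1
      = symmPart w y ⁅x, z⁆ a b - symmPart w y ⁅x, z⁆ (a * b) 1 := by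
    intro x y z
    have h1 := two_smul_component_lie hcoc x y z a b
    have h2 := two_smul_component_lie hcoc x y z (a * b) 1
    rw [mul_one] at h2
    linear_combination (norm := module) h2 - h1
  have hskew : ∀ x y z, symmPart w x ⁅y, z⁆ a b - symmPart w x ⁅y, z⁆ (a * b) 1
      = -(symmPart w x ⁅z, y⁆ a b - symmPart w x ⁅z, y⁆ (a * b) 1) := by
    intro x y z
    rw [← lie_skew y z]
    simp only [map_neg, LinearMap.neg_apply]
    abel
  have hzero : ∀ x y z : k, symmPart w x ⁅y, z⁆ a b - symmPart w x ⁅y, z⁆ (a * b) 1 = 0 := by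
    intro x y z
    have h : (2 : 𝔽) • (symmPart w x ⁅y, z⁆ a b - symmPart w x ⁅y, z⁆ (a * b) 1) = 0 := by
      linear_combination (norm := module) hswap x y z + hskew y x z - hswap y z x - hskew z y x
        + hswap z x y + hskew x z y
    exact (smul_eq_zero.1 h).resolve_left two_ne_zero
  have hext := bilinear_ext_of_perfect (𝔽 := 𝔽) hperf
    (f := (evalPair a b ∘ₗ symmPart w x))
    (g := (evalPair (a * b) 1 ∘ₗ symmPart w x))
    (fun (y z : k) => sub_eq_zero.1 (hzero x y z))
  exact LinearMap.congr_fun hext y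

theorem skewPart_one_eq_zero [FiniteDimensional 𝔽 k] {κ : k →ₗ[𝔽] k →ₗ[𝔽] 𝔽}
    (hκsymm : ∀ x y : k, κ x y = κ y x)
    (hκinv : ∀ x y z : k, κ ⁅x, y⁆ z = κ x ⁅y, z⁆)
    (hκnd : ∀ x : k, (∀ y : k, κ x y = 0) → x = 0)
    (hderinv : ∀ D : k →ₗ[𝔽] k, (∀ x y : k, D ⁅x, y⁆ = ⁅D x, y⁆ + ⁅x, D y⁆) →
      ∀ x y : k, κ (D x) y = - κ x (D y))
    (hw : ∀ x y a b, w x y a b = -w y x b a)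
    (hcoc : ∀ x y z a b c, w ⁅x, y⁆ z (a * b) c = w x ⁅y, z⁆ a (b * c) - w y ⁅x, z⁆ b (a * c))
    (x y : k) (c : A) : skewPart w x y c 1 = 0 := by
  refine eq_zero_of_forall_functional_eq_zero (𝔽 := 𝔽) fun L => ?_
  let E : (A →ₗ[𝔽] A →ₗ[𝔽] M) →ₗ[𝔽] 𝔽 :=
    L ∘ₗ evalPair c 1
  refine invariant_form_eq_zero_of_coboundary hκsymm hκinv hκnd hderinv
    ((skewPart w).compr₂ E) ((symmPart w).compr₂ E) (fun x y => ?_) (fun x y z => ?_)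
    (fun x y => ?_) (fun x y z => ?_) x y
  · exact congrArg L (skewPart_symm hw x y c 1)
  · exact congrArg L (skewPart_invariant hw hcoc x y z c 1)
  · exact (congrArg L (symmPart_skew hw x y c 1)).trans (map_neg L _)
  · change L (skewPart w ⁅x, y⁆ z c 1) + L (symmPart w ⁅x, y⁆ z c 1)
      = L (symmPart w x ⁅y, z⁆ c 1) - L (symmPart w y ⁅x, z⁆ c 1)
    have h := two_smul_component_lie hcoc x y z c 1
    rw [mul_one] at h
    rw [← map_add, ← map_sub, ← h, skewPart_add_symmPart]

theorem skewPart_hochschild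
    (hperf : ∀ z : k, z ∈ Submodule.span 𝔽 {w : k | ∃ x y : k, ⁅x, y⁆ = w})
    (hone : ∀ x y c, skewPart w x y c 1 = 0)
    (hw : ∀ x y a b, w x y a b = -w y x b a)
    (hcoc : ∀ x y z a b c, w ⁅x, y⁆ z (a * b) c = w x ⁅y, z⁆ a (b * c) - w y ⁅x, z⁆ b (a * c))
    (x y : k) (a b c : A) :
    skewPart w x y (a * b) c = skewPart w x y a (b * c) + skewPart w x y b (a * c) := by
  have hlie : ∀ x y z : k, skewPart w x ⁅y, z⁆ (a * b) c
      = skewPart w x ⁅y, z⁆ a (b * c) + skewPart w x ⁅y, z⁆ b (a * c) := by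
    intro x y z
    have h1 := congrArg (fun m => (2 : 𝔽) • m) (hcoc x y z a b c)
    simp only [smul_sub, ← skewPart_add_symmPart] at h1
    rw [symmPart_eq_mul_one hperf hcoc ⁅x, y⁆ z, symmPart_eq_mul_one hperf hcoc x,
      symmPart_eq_mul_one hperf hcoc y, ← mul_assoc a b c, ← mul_assoc b a c, mul_comm b a,
      symmPart_cocycle hone hcoc, skewPart_invariant hw hcoc] at h1
    linear_combination (norm := module) h1 - skewPart_lie_swap hcoc y x z b (a * c)
  have hext := bilinear_ext_of_perfect (𝔽 := 𝔽) hperf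
    (f := (evalPair (a * b) c ∘ₗ skewPart w x))
    (g := (evalPair a (b * c) ∘ₗ skewPart w x)
      + (evalPair b (a * c) ∘ₗ skewPart w x))
    (fun (y z : k) => hlie x y z)
  exact LinearMap.congr_fun hext y

end Current

section Components

variable {𝔽 k W : Type*} [Field 𝔽] [LieRing k] [LieAlgebra 𝔽 k] [AddCommGroup W] [Module 𝔽 W]

theorem exists_coefficients_of_forms {ι : Type*} [Fintype ι] (β : ι → (k →ₗ[𝔽] k →ₗ[𝔽] 𝔽))
    (q : k →ₗ[𝔽] k →ₗ[𝔽] W)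
    (h : ∀ L : W →ₗ[𝔽] 𝔽, ∃ (c : ι → 𝔽) (g : k →ₗ[𝔽] 𝔽),
      ∀ x y : k, L (q x y) = ∑ i, c i * β i x y + g ⁅x, y⁆) :
    ∃ (f : ι → W) (G : k →ₗ[𝔽] W), ∀ x y, q x y = ∑ i, β i x y • f i + G ⁅x, y⁆ := by
  classical
  let p : k →ₗ[𝔽] k →ₗ[𝔽] ((ι → 𝔽) × k) :=
    LinearMap.mk₂ 𝔽 (fun x y => (fun i => β i x y, ⁅x, y⁆))
      (fun _ _ _ => by ext <;> simp) (fun _ _ _ => by ext <;> simp)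
      (fun _ _ _ => by ext <;> simp) (fun _ _ _ => by ext <;> simp)
  obtain ⟨G, hG⟩ := exists_bilinear_factor p q (by
    intro L
    obtain ⟨c, g, hcg⟩ := h L
    refine ⟨(Fintype.linearCombination 𝔽 c).coprod g, fun x y => ?_⟩
    simp [p, hcg, Fintype.linearCombination_apply, mul_comm])
  refine ⟨fun i => G (Pi.single i 1, 0), G ∘ₗ LinearMap.inr 𝔽 _ _, fun x y => ?_⟩
  have hp : p x y = ∑ i, β i x y • ((Pi.single i 1, 0) : (ι → 𝔽) × k) + (0, ⁅x, y⁆) := by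
    ext i <;> simp [p, Prod.fst_sum, Prod.snd_sum, Pi.single_apply]
  rw [hG, hp]
  simp only [map_add, map_sum, map_smul, LinearMap.comp_apply, LinearMap.inr_apply]

theorem eq_zero_of_sum_forms_smul_eq_zero {ι : Type*} [Fintype ι]
    {β : ι → (k →ₗ[𝔽] k →ₗ[𝔽] 𝔽)} (hβ : LinearIndependent 𝔽 β) {v : ι → W}
    (h : ∀ x y, ∑ i, β i x y • v i = 0) (i : ι) : v i = 0 := by
  refine eq_zero_of_forall_functional_eq_zero (𝔽 := 𝔽) fun L => ?_
  refine Fintype.linearIndependent_iffₛ.1 hβ (fun i => L (v i)) 0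
    (LinearMap.ext₂ fun x y => ?_) i
  have := congrArg L (h x y)
  simp only [map_sum, map_smul, map_zero, smul_eq_mul] at this
  simp only [LinearMap.sum_apply, LinearMap.smul_apply, Pi.zero_apply, smul_eq_mul,
    zero_mul, Finset.sum_const_zero]
  simpa only [mul_comm] using this

end Components

/-- Theorem `cor1` of the paper, purely even case.
Let `k` be a finite-dimensional perfect Lie algebra over a field `𝔽` of characteristic
zero with a nondegenerate invariant symmetric bilinear form `κ` which is derivation
invariant.  Let `D₁, …, D_t` be derivations of `k` whose cohomology classes
`[κ_{Dᵢ}]` form a basis of `H²(k) = Z²(k)/B²(k)`, and let `S₁, …, S_m ∈ cent₊(k)` be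
such that the `κ_{Sⱼ}` form a basis of the space of invariant symmetric bilinear forms
on `k`.  Then every 2-cocycle `ω` of the current algebra `A ⊗ k` with values in an
`𝔽`-vector space `M` is cohomologous to a cocycle of the form
`(a⊗x, b⊗y) ↦ Σᵢ fᵢ(ab)·κ(Dᵢ x, y) + Σⱼ Fⱼ(a,b)·κ(Sⱼ x, y)` for suitable linear maps
`fᵢ : A → M` and Hochschild maps `Fⱼ`. -/
theorem two_cocycle_of_current_algebra_cohomologous_to_standard_form
    {𝔽 : Type*} [Field 𝔽] [CharZero 𝔽]
    {k : Type*} [LieRing k] [LieAlgebra 𝔽 k] [FiniteDimensional 𝔽 k]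
    {A : Type*} [CommRing A] [Algebra 𝔽 A]
    {M : Type*} [AddCommGroup M] [Module 𝔽 M]
    (hperf : ∀ z : k, z ∈ Submodule.span 𝔽 {w : k | ∃ x y : k, ⁅x, y⁆ = w})
    (κ : k →ₗ[𝔽] k →ₗ[𝔽] 𝔽)
    (hκsymm : ∀ x y : k, κ x y = κ y x)
    (hκinv : ∀ x y z : k, κ ⁅x, y⁆ z = κ x ⁅y, z⁆)
    (hκnd : ∀ x : k, (∀ y : k, κ x y = 0) → x = 0)
    (hderinv : ∀ D : k →ₗ[𝔽] k, (∀ x y : k, D ⁅x, y⁆ = ⁅D x, y⁆ + ⁅x, D y⁆) →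
      ∀ x y : k, κ (D x) y = - κ x (D y))
    -- the derivations `D₁, …, D_t`, whose cocycles represent a basis of `H²(k)`
    (t : ℕ) (D : Fin t → (k →ₗ[𝔽] k))
    (hDder : ∀ i, ∀ x y : k, D i ⁅x, y⁆ = ⁅D i x, y⁆ + ⁅x, D i y⁆)
    (hH2span : ∀ β : k →ₗ[𝔽] k →ₗ[𝔽] 𝔽,
      (∀ x y : k, β x y = - β y x) →
      (∀ x y z : k, β ⁅x, y⁆ z = β x ⁅y, z⁆ - β y ⁅x, z⁆) →
      ∃ (c : Fin t → 𝔽) (g : k →ₗ[𝔽] 𝔽),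
        ∀ x y : k, β x y = ∑ i, c i * κ (D i x) y + g ⁅x, y⁆)
    (hH2indep : ∀ c : Fin t → 𝔽,
      (∃ g : k →ₗ[𝔽] 𝔽, ∀ x y : k, ∑ i, c i * κ (D i x) y = g ⁅x, y⁆) → c = 0)
    -- the centroid elements `S₁, …, S_m`
    (m : ℕ) (S : Fin m → (k →ₗ[𝔽] k))
    (hScent : ∀ j, ∀ x y : k, S j ⁅x, y⁆ = ⁅S j x, y⁆)
    (hSsym : ∀ j, ∀ x y : k, κ (S j x) y = κ x (S j y))
    (hSindep : LinearIndependent 𝔽 (fun j => κ ∘ₗ S j))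
    (hSspan : ∀ β : k →ₗ[𝔽] k →ₗ[𝔽] 𝔽,
      (∀ x y : k, β x y = β y x) →
      (∀ x y z : k, β ⁅x, y⁆ z = β x ⁅y, z⁆) →
      β ∈ Submodule.span 𝔽 (Set.range fun j => κ ∘ₗ S j))
    -- the 2-cocycle `ω` of the current algebra
    (ω : (A ⊗[𝔽] k) →ₗ[𝔽] (A ⊗[𝔽] k) →ₗ[𝔽] M)
    (hωskew : ∀ X Y : A ⊗[𝔽] k, ω X Y = - ω Y X)
    (hωcoc : ∀ X Y Z : A ⊗[𝔽] k, ω ⁅X, Y⁆ Z = ω X ⁅Y, Z⁆ - ω Y ⁅X, Z⁆) :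
    ∃ (f : Fin t → (A →ₗ[𝔽] M)) (F : Fin m → (A →ₗ[𝔽] A →ₗ[𝔽] M))
      (ℓ : (A ⊗[𝔽] k) →ₗ[𝔽] M),
      (∀ j, ∀ a b : A, F j a b = - F j b a) ∧
      (∀ j, ∀ a b c : A, F j (a * b) c = F j a (b * c) + F j b (a * c)) ∧
      (∀ (a b : A) (x y : k),
        ω (a ⊗ₜ x) (b ⊗ₜ y)
          = ∑ i, κ (D i x) y • f i (a * b)
            + ∑ j, κ (S j x) y • F j a b
            + ℓ ((a * b) ⊗ₜ ⁅x, y⁆)) := by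
  set w := currentComponents ω
  have hw : ∀ x y a b, w x y a b = -w y x b a := fun x y a b => hωskew _ _
  have hcoc : ∀ x y z a b c,
      w ⁅x, y⁆ z (a * b) c = w x ⁅y, z⁆ a (b * c) - w y ⁅x, z⁆ b (a * c) := by
    intro x y z a b c
    have h := hωcoc (a ⊗ₜ x) (b ⊗ₜ y) (c ⊗ₜ z)
    simp only [LieAlgebra.ExtendScalars.bracket_tmul] at h
    exact h
  have hone : ∀ x y c, skewPart w x y c 1 = 0 :=
    skewPart_one_eq_zero hκsymm hκinv hκnd hderinv hw hcoc
  -- the part that is symmetric in the arguments from `A`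
  let evalOne : (A →ₗ[𝔽] A →ₗ[𝔽] M) →ₗ[𝔽] (A →ₗ[𝔽] M) :=
    LinearMap.applyₗ (R := 𝔽) (1 : A) ∘ₗ LinearMap.lflip.toLinearMap
  obtain ⟨f, G, hfG⟩ := exists_coefficients_of_forms (fun i => κ ∘ₗ D i)
    ((symmPart w).compr₂ evalOne) (by
      intro L
      refine hH2span ((symmPart w).compr₂ (L ∘ₗ evalOne)) (fun x y => ?_) (fun x y z => ?_)
      · have : evalOne (symmPart w x y) = -evalOne (symmPart w y x) :=
          LinearMap.ext fun c => symmPart_skew hw x y c 1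
        exact (congrArg L this).trans (map_neg L _)
      · have : evalOne (symmPart w ⁅x, y⁆ z)
            = evalOne (symmPart w x ⁅y, z⁆) - evalOne (symmPart w y ⁅x, z⁆) :=
          LinearMap.ext fun c => symmPart_cocycle hone hcoc x y z c
        exact (congrArg L this).trans (map_sub L _ _))
  -- the part that is skew in the arguments from `A`
  obtain ⟨F, H, hFH⟩ := exists_coefficients_of_forms (fun j => κ ∘ₗ S j) (skewPart w) (by
    intro L
    have hmem := hSspan ((skewPart w).compr₂ L)
      (fun x y => congrArg L (LinearMap.ext₂ (skewPart_symm hw x y)))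
      (fun x y z => congrArg L (LinearMap.ext₂ (skewPart_invariant hw hcoc x y z)))
    obtain ⟨c, hc⟩ := (Submodule.mem_span_range_iff_exists_fun 𝔽).1 hmem
    refine ⟨c, 0, fun x y => ?_⟩
    simpa using (LinearMap.congr_fun₂ hc x y).symm)
  have hFsum : ∀ x y a b, skewPart w x y a b = ∑ j, κ (S j x) y • F j a b := by
    intro x y a b
    have h1 := LinearMap.congr_fun₂ (hFH x y) a b
    have h2 := LinearMap.congr_fun₂ (hFH y x) a b
    simp only [LinearMap.add_apply, LinearMap.sum_apply, LinearMap.smul_apply,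
      LinearMap.comp_apply] at h1 h2
    have h3 : ∀ j, κ (S j y) x = κ (S j x) y := fun j => by rw [hκsymm, hSsym]
    rw [← skewPart_symm hw, ← lie_skew] at h2
    simp only [h3, map_neg, LinearMap.neg_apply] at h2
    have h4 : (2 : 𝔽) • skewPart w x y a b = (2 : 𝔽) • ∑ j, κ (S j x) y • F j a b := by
      linear_combination (norm := module) h1 + h2
    exact smul_right_injective M (two_ne_zero (α := 𝔽)) h4
  have hFzero : ∀ v : Fin m → M, (∀ x y, ∑ j, κ (S j x) y • v j = 0) → ∀ j, v j = 0 :=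
    fun v hv => eq_zero_of_sum_forms_smul_eq_zero hSindep hv
  refine ⟨fun i => (2⁻¹ : 𝔽) • f i, fun j => (2⁻¹ : 𝔽) • F j,
    (2⁻¹ : 𝔽) • TensorProduct.lift G.flip, fun j a b => ?_, fun j a b c => ?_, fun a b x y => ?_⟩
  · have h := hFzero (fun j => F j a b + F j b a) (fun x y => by
      simp only [smul_add, Finset.sum_add_distrib, ← hFsum]
      rw [skewPart_swap, neg_add_cancel]) j
    simp only [LinearMap.smul_apply, ← smul_neg, eq_neg_of_add_eq_zero_left h]
  · have h := hFzero (fun j => F j (a * b) c - (F j a (b * c) + F j b (a * c))) (fun x y => by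
      simp only [smul_add, smul_sub, Finset.sum_add_distrib, Finset.sum_sub_distrib, ← hFsum]
      rw [skewPart_hochschild hperf hone hw hcoc, sub_self]) j
    simp only [LinearMap.smul_apply, ← smul_add, sub_eq_zero.1 h]
  · have h1 : symmPart w x y (a * b) 1
        = ∑ i, κ (D i x) y • f i (a * b) + G ⁅x, y⁆ (a * b) := by
      have h := LinearMap.congr_fun (hfG x y) (a * b)
      simp only [LinearMap.add_apply, LinearMap.sum_apply, LinearMap.smul_apply,
        LinearMap.comp_apply] at h
      exact h
    have h2 := skewPart_add_symmPart w x y a b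
    rw [symmPart_eq_mul_one hperf hcoc, h1, hFsum] at h2
    refine smul_right_injective M (two_ne_zero (α := 𝔽)) (h2.symm.trans ?_)
    simp only [LinearMap.smul_apply, TensorProduct.lift.tmul, LinearMap.flip_apply, smul_add,
      smul_comm _ (2⁻¹ : 𝔽), ← Finset.smul_sum]
    module
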